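/- Let G be a finite connected loopless graph of genus g = |E(G)| − |V(G)| + 1, let q ∈ V(G), and let σ* be an acyclic cocycle signature of G. Then every divisor on G of degree g is linearly equivalent to exactly one element of the set of generalized break divisors BD_{I_G^{σ*}}(G). -/

import Mathlib

open Finset

open scoped Classical

section MultiGraph

variable {V E : Type*} [Fintype V] [Fintype E] [DecidableEq V] [DecidableEq E]

/-- Degree of a vertex in the loopless multigraph with edge-endpoint maps `s`, `t`. -/
def deg (s t : E → V) (v : V) : ℕ :=
  (Finset.univ.filter fun e => s e = v).card + (Finset.univ.filter fun e => t e = v).card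

/-- Edges with both endpoints in `W` (edge set of the induced subgraph `G[W]`). -/
def inEdges (s t : E → V) (W : Finset V) : Finset E :=
  Finset.univ.filter fun e => s e ∈ W ∧ t e ∈ W

/-- Edges with exactly one endpoint in `W` (the cut `E(W, Wᶜ)`). -/
def cutEdges (s t : E → V) (W : Finset V) : Finset E :=
  Finset.univ.filter fun e => (s e ∈ W ∧ t e ∉ W) ∨ (s e ∉ W ∧ t e ∈ W)

/-- Edges with one endpoint in `A` and the other in `B`. -/
def betweenEdges (s t : E → V) (A B : Finset V) : Finset E :=
  Finset.univ.filter fun e => (s e ∈ A ∧ t e ∈ B) ∨ (s e ∈ B ∧ t e ∈ A)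

/-- Reachability using only edges in `F`. -/
def Reach (s t : E → V) (F : Finset E) (a b : V) : Prop :=
  Relation.ReflTransGen (fun x y => ∃ e ∈ F, (s e = x ∧ t e = y) ∨ (s e = y ∧ t e = x)) a b

/-- The vertex set `W` is nonempty and connected using the edges in `F`. -/
def ConnOn (s t : E → V) (F : Finset E) (W : Finset V) : Prop :=
  W.Nonempty ∧ ∀ a ∈ W, ∀ b ∈ W, Reach s t F a b

/-- The induced subgraph `G[W]` is connected. -/
def IndConn (s t : E → V) (W : Finset V) : Prop :=
  ConnOn s t (inEdges s t W) W

/-- `W` is biconnected: both `G[W]` and `G[Wᶜ]` are connected (hence `W` is nontrivial). -/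
def Biconn (s t : E → V) (W : Finset V) : Prop :=
  IndConn s t W ∧ IndConn s t Wᶜ

/-- The genus `g(G) = |E| - |V| + 1` of the multigraph. -/
def genus (_s _t : E → V) : ℤ := (Fintype.card E : ℤ) - Fintype.card V + 1

/-- The genus `g(G[W]) = |E(G[W])| - |W| + 1` of the induced subgraph on `W`. -/
def indGenus (s t : E → V) (W : Finset V) : ℤ := ((inEdges s t W).card : ℤ) - W.card + 1

/-- The polarization `φ_pcan(v) = ((|E|+1)/(2|E|))·deg(v) − 1`. -/
noncomputable def pcan (s t : E → V) (v : V) : ℝ :=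
  ((Fintype.card E + 1 : ℝ) / (2 * Fintype.card E)) * deg s t v - 1

/-- A spanning tree: a connected spanning subgraph with `|V| - 1` edges. -/
def IsSpanningTree (s t : E → V) (T : Finset E) : Prop :=
  ConnOn s t T Finset.univ ∧ T.card + 1 = Fintype.card V

/-- For `e ∈ T`, the vertex set of the component of `T ∖ e` containing `s e`. -/
noncomputable def treeSide (s t : E → V) (T : Finset E) (e : E) : Finset V :=
  Finset.univ.filter fun v => Reach s t (T.erase e) (s e) v

/-- The head of the edge `e` under the orientation `o`
(`o e = true` means `e` is directed from `s e` to `t e`, i.e. as in the reference orientation). -/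
def ohead (s t : E → V) (o : E → Bool) (e : E) : V := if o e then t e else s e

/-- A cocycle signature, encoded as a choice, for each `W`, of a coherent orientation of the
cut `E(W,Wᶜ)`: `σ W = true` means all edges of the cut are directed towards `W`. -/
def IsSignature (s t : E → V) (σ : Finset V → Bool) : Prop :=
  ∀ W : Finset V, Biconn s t W → σ Wᶜ = ! σ W

/-- The orientation `T⃗*_σ` of a spanning tree `T`: each `e ∈ T` is directed as it is in
`σ(C*(T,e))`, where `C*(T,e)` is the fundamental cocycle `E(W_e, W_eᶜ)` with `W_e ∋ s e`. -/
noncomputable def sigmaOrient (s t : E → V) (σ : Finset V → Bool) (T : Finset E) : E → Bool :=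
  fun e => ! σ (treeSide s t T e)

/-- `σ` is triangulating: for every spanning tree `T`, every cocycle `E(W,Wᶜ)` (for biconnected
`W`) and every coherent orientation of it (towards `W` iff `b`), if every edge of the cocycle
lying in `T` is directed in `σ(C*(T,e))` the same way as in that coherent orientation, then `σ`
assigns that orientation to the cocycle. -/
noncomputable def Triangulating (s t : E → V) (σ : Finset V → Bool) : Prop :=
  ∀ T : Finset E, IsSpanningTree s t T → ∀ W : Finset V, Biconn s t W → ∀ b : Bool,
    (∀ e ∈ cutEdges s t W ∩ T, (ohead s t (sigmaOrient s t σ T) e ∈ W ↔ b = true)) →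
    σ W = b

/-- The vector in `ℝ^E` associated to the coherently oriented cocycle `σ(E(W,Wᶜ))`:
`+1` on edges directed as in the reference orientation, `-1` on edges directed oppositely,
`0` off the cocycle. -/
noncomputable def cocycVec (s t : E → V) (σ : Finset V → Bool) (W : Finset V) : E → ℝ :=
  fun e =>
    if s e ∈ W ∧ t e ∉ W then (if σ W then -1 else 1)
    else if s e ∉ W ∧ t e ∈ W then (if σ W then 1 else -1)
    else 0

/-- `σ` is acyclic: the only nonnegative reals `a_W`, supported on the (biconnected) cocycles,
with `Σ_W a_W · σ(E(W,Wᶜ)) = 0` in `ℝ^E` are all zero. -/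
def AcyclicSig (s t : E → V) (σ : Finset V → Bool) : Prop :=
  ∀ a : Finset V → ℝ, (∀ W, 0 ≤ a W) → (∀ W, ¬ Biconn s t W → a W = 0) →
    (∑ W : Finset V, a W • cocycVec s t σ W) = 0 → ∀ W, a W = 0

/-- The degree-zero divisor `I_G^σ(T)(v) = indeg_{T⃗*_σ}(v) − 1 + [v = q]`. -/
noncomputable def IG (s t : E → V) (σ : Finset V → Bool) (q : V) (T : Finset E) : V → ℤ :=
  fun v => ((T.filter fun e => ohead s t (sigmaOrient s t σ T) e = v).card : ℤ) - 1
    + (if v = q then 1 else 0)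

/-- The break divisor `D(T, O_E)`: its value at `v` is the number of edges outside `T`
whose head under the orientation `o` is `v`. -/
def breakDiv (s t : E → V) (T : Finset E) (o : E → Bool) : V → ℤ :=
  fun v => ((Finset.univ.filter fun e => e ∉ T ∧ ohead s t o e = v).card : ℤ)

/-- The set of generalized break divisors `BD_{I_G^σ}(G)`. -/
noncomputable def BDset (s t : E → V) (σ : Finset V → Bool) (q : V) : Set (V → ℤ) :=
  { D | ∃ T : Finset E, ∃ o : E → Bool, IsSpanningTree s t T ∧
      D = fun v => breakDiv s t T o v + IG s t σ q T v }

/-- The graph Laplacian acting on `ℤ^V`. -/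
def lap (s t : E → V) (f : V → ℤ) : V → ℤ :=
  fun v => ∑ e : E, ((if s e = v then 1 else 0) - (if t e = v then 1 else 0)) * (f (s e) - f (t e))

/-- Linear (chip-firing) equivalence of divisors. -/
def LinEquiv (s t : E → V) (D D' : V → ℤ) : Prop :=
  ∃ f : V → ℤ, ∀ v, D v - D' v = lap s t f v

/-- A numerical polarization `φ` is generic if `φ_W − |E(W,Wᶜ)|/2 ∉ ℤ` for every
nontrivial biconnected `W`. -/
def Generic (s t : E → V) (φ : V → ℝ) : Prop :=
  ∀ W : Finset V, Biconn s t W →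
    ∀ n : ℤ, (∑ v ∈ W, φ v) - (cutEdges s t W).card / 2 ≠ (n : ℝ)

/-- `n(φ)_W = ⌈φ_W − |E(W,Wᶜ)|/2⌉`. -/
noncomputable def nphi (s t : E → V) (φ : V → ℝ) (W : Finset V) : ℤ :=
  ⌈(∑ v ∈ W, φ v) - (cutEdges s t W).card / 2⌉

end MultiGraph

section ChipFiring

variable {V E : Type*}

section Connectivity

variable {s t : E → V}

theorem Reach.symm {F : Finset E} {a b : V} (h : Reach s t F a b) : Reach s t F b a := by
  induction h with
  | refl => exact .refl
  | tail _ h ih =>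
    obtain ⟨e, he, h⟩ := h
    exact Relation.ReflTransGen.head ⟨e, he, h.symm⟩ ih

theorem Reach.trans {F : Finset E} {a b c : V} (h : Reach s t F a b) (h' : Reach s t F b c) :
    Reach s t F a c :=
  Relation.ReflTransGen.trans h h'

theorem Reach.edge {F : Finset E} {e : E} (he : e ∈ F) : Reach s t F (s e) (t e) :=
  Relation.ReflTransGen.single ⟨e, he, Or.inl ⟨rfl, rfl⟩⟩

theorem Reach.of_edges {F : Finset E} {P : V → Prop} (hP : ∀ e ∈ F, (P (s e) ↔ P (t e)))
    {a b : V} (h : Reach s t F a b) : P a ↔ P b := by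
  induction h with
  | refl => rfl
  | tail _ h ih =>
    obtain ⟨e, he, ⟨rfl, rfl⟩ | ⟨rfl, rfl⟩⟩ := h
    · exact ih.trans (hP e he)
    · exact ih.trans (hP e he).symm

theorem Reach.eq_of_edges {α : Type*} {F : Finset E} {g : V → α}
    (hg : ∀ e ∈ F, g (s e) = g (t e)) {a b : V} (h : Reach s t F a b) : g a = g b :=
  ((h.of_edges (P := fun v => g a = g v) fun e he => by rw [hg e he]).1 rfl)

theorem Reach.restrict {F F' : Finset E} {W : Finset V}
    (hF : ∀ e ∈ F, (s e ∈ W ↔ t e ∈ W)) (hF' : ∀ e ∈ F, s e ∈ W → t e ∈ W → e ∈ F')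
    {a b : V} (ha : a ∈ W) (h : Reach s t F a b) : Reach s t F' a b := by
  suffices b ∈ W ∧ Reach s t F' a b from this.2
  induction h with
  | refl => exact ⟨ha, .refl⟩
  | tail _ h ih =>
    obtain ⟨e, he, ⟨rfl, rfl⟩ | ⟨rfl, rfl⟩⟩ := h
    · have h' := (hF e he).1 ih.1
      exact ⟨h', ih.2.trans (Reach.edge (hF' e he ih.1 h'))⟩
    · have h' := (hF e he).2 ih.1
      exact ⟨h', ih.2.trans (Reach.edge (hF' e he h' ih.1)).symm⟩

/-- A nonempty set that is not connected by `F` splits into two nonempty parts with no `F`-edge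
between them. -/
theorem exists_split_of_not_connOn [DecidableEq V] {F : Finset E} {W : Finset V} (hW : W.Nonempty)
    (h : ¬ ConnOn s t F W) : ∃ A ⊆ W, A.Nonempty ∧ (W \ A).Nonempty ∧
      ∀ e ∈ F, s e ∈ W → t e ∈ W → (s e ∈ A ↔ t e ∈ A) := by
  simp only [ConnOn, hW, true_and, not_forall] at h
  obtain ⟨a, ha, b, hb, hab⟩ := h
  refine ⟨W.filter fun v => Reach s t F a v, filter_subset _ _, ⟨a, ?_⟩, ⟨b, ?_⟩, ?_⟩
  · exact mem_filter.2 ⟨ha, .refl⟩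
  · simp [hb, hab]
  · intro e he hs ht
    simp only [mem_filter, hs, ht, true_and]
    exact ⟨fun h => h.trans (Reach.edge he), fun h => h.trans (Reach.edge he).symm⟩

end Connectivity

section SpanningTrees

variable {s t : E → V}

/-- The simple graph underlying the edge set `F`. -/
def edgeGraph (s t : E → V) (F : Finset E) : SimpleGraph V :=
  SimpleGraph.fromRel fun x y => ∃ e ∈ F, s e = x ∧ t e = y

theorem edgeGraph_adj {F : Finset E} {x y : V} : (edgeGraph s t F).Adj x y ↔
    x ≠ y ∧ ∃ e ∈ F, (s e = x ∧ t e = y) ∨ (s e = y ∧ t e = x) := by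
  simp only [edgeGraph, SimpleGraph.fromRel_adj]
  grind

theorem reach_iff_reachable {F : Finset E} {a b : V} :
    Reach s t F a b ↔ (edgeGraph s t F).Reachable a b := by
  rw [SimpleGraph.reachable_iff_reflTransGen]
  constructor
  · intro h
    induction h with
    | refl => rfl
    | @tail b c _ h ih =>
      by_cases hbc : b = c
      · exact hbc ▸ ih
      · exact ih.tail (edgeGraph_adj.2 ⟨hbc, h⟩)
  · exact fun h => Relation.ReflTransGen.mono (fun x y h => (edgeGraph_adj.1 h).2) a b h

variable [Fintype V]

theorem edgeGraph_connected {F : Finset E} (h : ConnOn s t F univ) :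
    (edgeGraph s t F).Connected := by
  obtain ⟨a, -⟩ := h.1
  exact (SimpleGraph.connected_iff _).2
    ⟨fun a b => reach_iff_reachable.1 (h.2 a (mem_univ _) b (mem_univ _)), ⟨a⟩⟩

theorem ConnOn.card_le {F : Finset E} (h : ConnOn s t F univ) : Fintype.card V ≤ F.card + 1 := by
  have h1 := (edgeGraph_connected h).card_vert_le_card_edgeSet_add_one
  rw [Nat.card_eq_fintype_card] at h1
  refine h1.trans (Nat.add_le_add_right ?_ 1)
  have hsub : (edgeGraph s t F).edgeSet ⊆ (F.image fun e => s(s e, t e) : Finset (Sym2 V)) := by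
    intro z
    induction z with | _ x y =>
    intro hz
    obtain ⟨-, e, he, ⟨rfl, rfl⟩ | ⟨rfl, rfl⟩⟩ := edgeGraph_adj.1 hz
    · exact mem_coe.2 (mem_image.2 ⟨e, he, rfl⟩)
    · exact mem_coe.2 (mem_image.2 ⟨e, he, Sym2.eq_swap⟩)
  calc Nat.card (edgeGraph s t F).edgeSet
      ≤ Nat.card ((F.image fun e => s(s e, t e) : Finset (Sym2 V)) : Set (Sym2 V)) :=
        Nat.card_mono (Finset.finite_toSet _) hsub
    _ = (F.image fun e => s(s e, t e)).card := by simp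
    _ ≤ F.card := card_image_le

theorem ConnOn.exists_isSpanningTree {F : Finset E} (h : ConnOn s t F univ) :
    ∃ T ⊆ F, IsSpanningTree s t T := by
  obtain ⟨H, hle, hH⟩ := (edgeGraph_connected h).exists_isTree_le
  have hex : ∀ z : H.edgeSet, ∃ e ∈ F, s(s e, t e) = z.1 := by
    rintro ⟨z, hz⟩
    induction z with | _ x y =>
    obtain ⟨-, e, he, ⟨rfl, rfl⟩ | ⟨rfl, rfl⟩⟩ := edgeGraph_adj.1 (hle hz)
    · exact ⟨e, he, rfl⟩
    · exact ⟨e, he, Sym2.eq_swap⟩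
  choose c hcF hc using hex
  have hTF : univ.image c ⊆ F := by
    intro e he
    obtain ⟨z, -, rfl⟩ := mem_image.1 he
    exact hcF z
  have hconn : ConnOn s t (univ.image c) univ := by
    refine ⟨h.1, fun a _ b _ => ?_⟩
    have hab := (SimpleGraph.reachable_iff_reflTransGen a b).1 (hH.connected.preconnected a b)
    refine Relation.ReflTransGen.mono (fun x y hxy => ?_) a b hab
    have := hc ⟨s(x, y), hxy⟩
    exact ⟨_, mem_image_of_mem c (mem_univ ⟨s(x, y), hxy⟩), by simpa using this⟩
  refine ⟨_, hTF, hconn, le_antisymm ?_ hconn.card_le⟩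
  rw [← hH.card_edgeFinset]
  refine Nat.add_le_add_right (card_image_le.trans ?_) 1
  simp [SimpleGraph.edgeFinset]

end SpanningTrees

section Cuts

variable {s t : E → V} [Fintype V]

/-- An edge of a spanning tree has both ends on the same side of the fundamental cut of every
other edge. -/
theorem mem_treeSide_iff_of_ne [DecidableEq E] {T : Finset E} {e e' : E} (he' : e' ∈ T)
    (hne : e' ≠ e) : s e' ∈ treeSide s t T e ↔ t e' ∈ treeSide s t T e := by
  have h : e' ∈ T.erase e := mem_erase.2 ⟨hne, he'⟩
  simp only [treeSide, mem_filter, mem_univ, true_and]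
  exact ⟨fun h' => h'.trans (Reach.edge h), fun h' => h'.trans (Reach.edge h).symm⟩

theorem source_mem_treeSide [DecidableEq E] (T : Finset E) (e : E) : s e ∈ treeSide s t T e := by
  exact mem_filter.2 ⟨mem_univ _, .refl⟩

theorem reach_erase_or [DecidableEq E] {T : Finset E} (hT : IsSpanningTree s t T) (e : E) (v : V) :
    Reach s t (T.erase e) (s e) v ∨ Reach s t (T.erase e) (t e) v := by
  have h := hT.1.2 (s e) (mem_univ _) v (mem_univ _)
  refine (h.of_edges (P := fun v => Reach s t (T.erase e) (s e) v ∨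
    Reach s t (T.erase e) (t e) v) fun e' he' => ?_).1 (Or.inl .refl)
  by_cases hne : e' = e
  · subst hne
    exact ⟨fun _ => Or.inr .refl, fun _ => Or.inl .refl⟩
  · have h : e' ∈ T.erase e := mem_erase.2 ⟨hne, he'⟩
    exact ⟨Or.imp (·.trans (Reach.edge h)) (·.trans (Reach.edge h)),
      Or.imp (·.trans (Reach.edge h).symm) (·.trans (Reach.edge h).symm)⟩

theorem target_notMem_treeSide [DecidableEq E] {T : Finset E} (hT : IsSpanningTree s t T) {e : E}
    (he : e ∈ T) : t e ∉ treeSide s t T e := by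
  intro h
  simp only [treeSide, mem_filter, mem_univ, true_and] at h
  have hs : ∀ v, Reach s t (T.erase e) (s e) v := fun v =>
    (reach_erase_or hT e v).elim id h.trans
  have hconn : ConnOn s t (T.erase e) univ :=
    ⟨hT.1.1, fun a _ b _ => (hs a).symm.trans (hs b)⟩
  have h1 := hconn.card_le
  have h2 := hT.2
  have h3 := card_erase_add_one he
  omega

variable [Fintype E] [DecidableEq V]

/-- Fundamental cuts are cocycles. -/
theorem biconn_treeSide [DecidableEq E] {T : Finset E} (hT : IsSpanningTree s t T) {e : E}
    (he : e ∈ T) : Biconn s t (treeSide s t T e) := by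
  have hside : ∀ e' ∈ T.erase e, (s e' ∈ treeSide s t T e ↔ t e' ∈ treeSide s t T e) :=
    fun e' he' => mem_treeSide_iff_of_ne (mem_of_mem_erase he') (ne_of_mem_erase he')
  have key : ∀ (W : Finset V) (r : V), r ∈ W →
      (∀ e' ∈ T.erase e, (s e' ∈ W ↔ t e' ∈ W)) →
      (∀ v ∈ W, Reach s t (T.erase e) r v) → IndConn s t W := by
    intro W r hr hW hreach
    have hin : ∀ v ∈ W, Reach s t (inEdges s t W) r v := fun v hv =>
      (hreach v hv).restrict hW (fun e' _ h1 h2 => by simp [inEdges, h1, h2]) hr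
    exact ⟨⟨r, hr⟩, fun a ha b hb => (hin a ha).symm.trans (hin b hb)⟩
  refine ⟨key _ (s e) (source_mem_treeSide T e) hside ?_, key _ (t e) ?_ ?_ ?_⟩
  · intro v hv
    simpa [treeSide] using hv
  · simpa using target_notMem_treeSide hT he
  · intro e' he'
    simpa using not_congr (hside e' he')
  · intro v hv
    refine (reach_erase_or hT e v).resolve_left ?_
    simpa [treeSide] using hv

omit [Fintype V] in
theorem mem_cutEdges {W : Finset V} {e : E} : e ∈ cutEdges s t W ↔ ¬ (s e ∈ W ↔ t e ∈ W) := by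
  simp only [cutEdges, mem_filter, mem_univ, true_and]
  tauto

theorem cutEdges_nonempty (hconn : ConnOn s t univ univ) {W : Finset V} (hW : W.Nonempty)
    (hW' : Wᶜ.Nonempty) : (cutEdges s t W).Nonempty := by
  obtain ⟨a, ha⟩ := hW
  obtain ⟨b, hb⟩ := hW'
  by_contra h
  rw [not_nonempty_iff_eq_empty] at h
  have h1 : ∀ e ∈ (univ : Finset E), (s e ∈ W ↔ t e ∈ W) := by
    intro e _
    by_contra h2
    have := mem_cutEdges.2 h2
    simp [h] at this
  exact (mem_compl.1 hb)
    (((hconn.2 a (mem_univ _) b (mem_univ _)).of_edges (P := (· ∈ W)) h1).1 ha)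

/-- The cut of a nonempty proper vertex set contains a cocycle with compatible sides. -/
theorem exists_biconn (hconn : ConnOn s t univ univ) {W : Finset V} (hW : W.Nonempty)
    (hW' : Wᶜ.Nonempty) : ∃ B : Finset V, Biconn s t B ∧
      ∀ e ∈ cutEdges s t B, e ∈ cutEdges s t W ∧ (s e ∈ B ↔ s e ∈ W) := by
  induction hn : (cutEdges s t W).card using Nat.strong_induction_on generalizing W with
  | _ n ih =>
  subst hn
  have descend : ∀ A : Finset V, A.Nonempty → Aᶜ.Nonempty →
      (∀ e ∈ cutEdges s t A, e ∈ cutEdges s t W ∧ (s e ∈ A ↔ s e ∈ W)) →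
      (∃ e ∈ cutEdges s t W, e ∉ cutEdges s t A) →
      ∃ B : Finset V, Biconn s t B ∧
        ∀ e ∈ cutEdges s t B, e ∈ cutEdges s t W ∧ (s e ∈ B ↔ s e ∈ W) := by
    rintro A hA hA' hsub ⟨e, heW, heA⟩
    obtain ⟨B, hB, hBA⟩ := ih _ (card_lt_card (ssubset_iff_of_subset
      (fun e he => (hsub e he).1) |>.2 ⟨e, heW, heA⟩)) hA hA' rfl
    refine ⟨B, hB, fun e he => ?_⟩
    have h1 := hBA e he
    have h2 := hsub e h1.1
    exact ⟨h2.1, h1.2.trans h2.2⟩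
  by_cases h1 : IndConn s t W
  · by_cases h2 : IndConn s t Wᶜ
    · exact ⟨W, ⟨h1, h2⟩, fun e he => ⟨he, Iff.rfl⟩⟩
    · obtain ⟨A, hAW, hA, hA', hsplit⟩ := exists_split_of_not_connOn hW' h2
      simp only [inEdges, mem_filter, mem_univ, true_and, and_imp] at hsplit
      obtain ⟨a, ha⟩ := hA
      obtain ⟨b, hb⟩ := hA'
      obtain ⟨e, he⟩ := cutEdges_nonempty hconn (W := Wᶜ \ A) ⟨b, hb⟩ ⟨a, by simp [ha]⟩
      refine descend Aᶜ ⟨b, by simp at hb; simp [hb]⟩ ⟨a, by simpa using ha⟩ ?_ ⟨e, ?_, ?_⟩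
      · intro e he
        have h3 := hsplit e
        have h4 := @hAW (s e)
        have h5 := @hAW (t e)
        simp only [mem_cutEdges, mem_compl] at he h3 h4 h5 ⊢
        grind
      all_goals
        have h3 := hsplit e
        have h4 := @hAW (s e)
        have h5 := @hAW (t e)
        simp only [mem_cutEdges, mem_compl, mem_sdiff] at he h3 h4 h5 ⊢
        grind
  · obtain ⟨A, hAW, hA, hA', hsplit⟩ := exists_split_of_not_connOn hW h1
    simp only [inEdges, mem_filter, mem_univ, true_and, and_imp] at hsplit
    obtain ⟨a, ha⟩ := hA
    obtain ⟨b, hb⟩ := hA'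
    obtain ⟨e, he⟩ := cutEdges_nonempty hconn (W := W \ A) ⟨b, hb⟩ ⟨a, by simp [ha]⟩
    refine descend A ⟨a, ha⟩ ⟨b, by simp at hb; simp [hb]⟩ ?_ ⟨e, ?_, ?_⟩
    · intro e he
      have h3 := hsplit e
      have h4 := @hAW (s e)
      have h5 := @hAW (t e)
      simp only [mem_cutEdges] at he h3 h4 h5 ⊢
      grind
    all_goals
      have h3 := hsplit e
      have h4 := @hAW (s e)
      have h5 := @hAW (t e)
      simp only [mem_cutEdges, mem_sdiff] at he h3 h4 h5 ⊢
      grind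

end Cuts

section Chains

variable {s t : E → V}

/-- The indicator function of a vertex set. -/
def indic [DecidableEq V] (W : Finset V) (v : V) : ℝ := if v ∈ W then 1 else 0

/-- The coboundary of a function on vertices. -/
def cob (s t : E → V) (y : V → ℝ) (e : E) : ℝ := y (t e) - y (s e)

/-- The boundary of a real 1-chain. -/
def bdry [Fintype E] [DecidableEq V] (s t : E → V) (z : E → ℝ) (v : V) : ℝ :=
  ∑ e, z e * ((if t e = v then 1 else 0) - (if s e = v then 1 else 0))

/-- The number of edges whose reference orientation has tail `v`. -/
def tailCount [Fintype E] [DecidableEq V] (s : E → V) (v : V) : ℤ := ∑ e, if s e = v then 1 else 0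

/-- The 0/1-valued chain of an orientation. -/
def bval (o : E → Bool) (e : E) : ℝ := if o e then 1 else 0

theorem cob_indic_compl [Fintype V] [DecidableEq V] (W : Finset V) (e : E) :
    cob s t (indic Wᶜ) e = - cob s t (indic W) e := by
  simp only [cob, indic, mem_compl]
  split_ifs <;> simp

theorem cob_indic_eq_zero [DecidableEq V] {W : Finset V} {e : E} (h : s e ∈ W ↔ t e ∈ W) :
    cob s t (indic W) e = 0 := by
  simp [cob, indic, h]

theorem cob_indic_of_source_mem [DecidableEq V] {W : Finset V} {e : E} (h : s e ∈ W)
    (h' : t e ∉ W) : cob s t (indic W) e = -1 := by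
  simp [cob, indic, h, h']

theorem cob_indic_of_target_mem [DecidableEq V] {W : Finset V} {e : E} (h : s e ∉ W)
    (h' : t e ∈ W) : cob s t (indic W) e = 1 := by
  simp [cob, indic, h, h']

variable [Fintype E] [DecidableEq V]

theorem bdry_add (z z' : E → ℝ) (v : V) : bdry s t (z + z') v = bdry s t z v + bdry s t z' v := by
  simp [bdry, add_mul, sum_add_distrib]

theorem bdry_sub (z z' : E → ℝ) (v : V) : bdry s t (z - z') v = bdry s t z v - bdry s t z' v := by
  simp [bdry, sub_mul, sum_sub_distrib]

theorem bdry_smul (c : ℝ) (z : E → ℝ) (v : V) : bdry s t (c • z) v = c * bdry s t z v := by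
  simp [bdry, mul_sum, mul_assoc]

/-- Boundary and coboundary are adjoint. -/
theorem sum_mul_bdry [Fintype V] (y : V → ℝ) (z : E → ℝ) :
    ∑ v, y v * bdry s t z v = ∑ e, z e * cob s t y e := by
  simp only [bdry, mul_sum]
  rw [sum_comm]
  refine sum_congr rfl fun e _ => ?_
  have h : ∀ v, y v * (z e * ((if t e = v then (1 : ℝ) else 0) - (if s e = v then 1 else 0))) =
      z e * ((if t e = v then y v else 0) - (if s e = v then y v else 0)) := by
    intro v
    split_ifs <;> ring
  simp only [h, ← mul_sum, sum_sub_distrib, sum_ite_eq, mem_univ, if_true, cob]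

theorem lap_eq_bdry (f : V → ℤ) (v : V) :
    (lap s t f v : ℝ) = bdry s t (cob s t fun v => (f v : ℝ)) v := by
  simp only [lap, bdry, cob]
  push_cast
  exact sum_congr rfl fun e _ => by ring

theorem bdry_single [DecidableEq E] (e : E) (v : V) : bdry s t (Pi.single e 1) v =
    (if t e = v then 1 else 0) - (if s e = v then 1 else 0) := by
  simp only [bdry, Pi.single_apply, ite_mul, one_mul, zero_mul, sum_ite_eq', mem_univ, if_true]

theorem exists_bdry_of_reach [DecidableEq E] {F : Finset E} {a b : V} (h : Reach s t F a b) :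
    ∃ z : E → ℝ, (∀ e ∉ F, z e = 0) ∧
      ∀ v, bdry s t z v = (if b = v then 1 else 0) - (if a = v then 1 else 0) := by
  induction h with
  | refl => exact ⟨0, by simp, by simp [bdry]⟩
  | tail _ h ih =>
    obtain ⟨z, hz, hzb⟩ := ih
    have hsupp : ∀ e ∈ F, ∀ e' ∉ F, (Pi.single e 1 : E → ℝ) e' = 0 := fun e he e' he' =>
      Pi.single_eq_of_ne (by rintro rfl; exact he' he) _
    obtain ⟨e, he, ⟨rfl, rfl⟩ | ⟨rfl, rfl⟩⟩ := h
    · refine ⟨z + Pi.single e 1, fun e' he' => by simp [hz e' he', hsupp e he e' he'],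
        fun v => ?_⟩
      rw [bdry_add, hzb, bdry_single]
      ring
    · refine ⟨z - Pi.single e 1, fun e' he' => by simp [hz e' he', hsupp e he e' he'],
        fun v => ?_⟩
      rw [bdry_sub, hzb, bdry_single]
      ring

theorem bdry_sum_smul {ι : Type*} (I : Finset ι) (c : ι → ℝ) (z : ι → E → ℝ) (v : V) :
    bdry s t (∑ i ∈ I, c i • z i) v = ∑ i ∈ I, c i * bdry s t (z i) v := by
  simp only [bdry, Finset.sum_apply, Pi.smul_apply, smul_eq_mul, sum_mul, mul_sum]
  rw [sum_comm]
  exact sum_congr rfl fun i _ => sum_congr rfl fun e _ => by ring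

/-- On a connected graph every function of total mass zero is a boundary. -/
theorem exists_bdry_eq [Fintype V] [DecidableEq E] (hconn : ConnOn s t univ univ) {h : V → ℝ}
    (h0 : ∑ v, h v = 0) : ∃ z : E → ℝ, ∀ v, bdry s t z v = h v := by
  obtain ⟨a, -⟩ := hconn.1
  choose z _ hz using fun b => exists_bdry_of_reach (hconn.2 a (mem_univ _) b (mem_univ _))
  refine ⟨∑ b, h b • z b, fun v => ?_⟩
  rw [bdry_sum_smul]
  simp only [hz, mul_sub, sum_sub_distrib, ← sum_mul, h0]
  simp

variable [Fintype V]

omit [Fintype E] in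
/-- Coboundaries expand in the fundamental cocycles of a spanning tree. -/
theorem cob_eq_sum_treeSide [DecidableEq E] {T : Finset E} (hT : IsSpanningTree s t T)
    (y : V → ℝ) (e : E) :
    cob s t y e = ∑ e' ∈ T, (- cob s t y e') * cob s t (indic (treeSide s t T e')) e := by
  set g : V → ℝ := fun v => y v + ∑ e' ∈ T, cob s t y e' * indic (treeSide s t T e') v with hg
  have hcob : ∀ e, cob s t g e =
      cob s t y e + ∑ e' ∈ T, cob s t y e' * cob s t (indic (treeSide s t T e')) e := by
    intro e
    have : ∀ x ∈ T, cob s t y x * cob s t (indic (treeSide s t T x)) e =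
        cob s t y x * indic (treeSide s t T x) (t e) -
          cob s t y x * indic (treeSide s t T x) (s e) := fun x _ => by rw [← mul_sub]; rfl
    rw [sum_congr rfl this, sum_sub_distrib]
    simp only [hg]
    rw [cob]
    simp only [cob]
    ring
  have hedge : ∀ e ∈ T, g (s e) = g (t e) := by
    intro e he
    have h1 := hcob e
    rw [sum_eq_single_of_mem e he, cob_indic_of_source_mem (source_mem_treeSide T e)
      (target_notMem_treeSide hT he)] at h1
    · have : g (t e) - g (s e) = cob s t g e := rfl
      linarith
    · intro e' _ hne
      rw [cob_indic_eq_zero (mem_treeSide_iff_of_ne he hne.symm), mul_zero]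
  have h2 : g (s e) = g (t e) := Reach.eq_of_edges hedge (hT.1.2 _ (mem_univ _) _ (mem_univ _))
  have h3 := hcob e
  have h4 : cob s t g e = 0 := by rw [cob, h2, sub_self]
  simp only [neg_mul, sum_neg_distrib]
  linarith

theorem sum_mul_cob_eq_sum_treeSide [DecidableEq E] {T : Finset E} (hT : IsSpanningTree s t T)
    (y : V → ℝ) (z : E → ℝ) :
    ∑ e, z e * cob s t y e =
      ∑ e' ∈ T, (- cob s t y e') * ∑ e, z e * cob s t (indic (treeSide s t T e')) e := by
  simp only [mul_sum]
  rw [sum_comm]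
  refine sum_congr rfl fun e _ => ?_
  rw [cob_eq_sum_treeSide hT y e, mul_sum]
  exact sum_congr rfl fun e' _ => by ring

end Chains

section Convexity

variable {s t : E → V} [Fintype V] [Fintype E] [DecidableEq V]

omit [Fintype V] [Fintype E] in
theorem cocycVec_eq (σ : Finset V → Bool) (W : Finset V) (e : E) :
    cocycVec s t σ W e = (if σ W then 1 else -1) * cob s t (indic W) e := by
  simp only [cocycVec, cob, indic]
  split_ifs <;> simp_all

/-- Gordan's alternative: an acyclic signature is induced by a real chain, which may be taken to
be small. -/
theorem AcyclicSig.exists_chain {σ : Finset V → Bool} (hacy : AcyclicSig s t σ) :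
    ∃ w : E → ℝ, (∀ W : Finset V, |∑ e, w e * cob s t (indic W) e| < 1) ∧
      ∀ B, Biconn s t B → (σ B = true → 0 < ∑ e, w e * cob s t (indic B) e) ∧
        (σ B = false → ∑ e, w e * cob s t (indic B) e < 0) := by
  suffices h : ∃ w : E → ℝ, ∀ B, Biconn s t B → 0 < ∑ e, w e * cocycVec s t σ B e by
    obtain ⟨w, hw⟩ := h
    set M : ℝ := 1 + ∑ e, |w e| with hM
    have hM0 : 0 < M := by positivity
    have hdiv : ∀ y : V → ℝ, ∑ e, w e / M * cob s t y e = (∑ e, w e * cob s t y e) / M := by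
      intro y
      rw [sum_div]
      exact sum_congr rfl fun e _ => by ring
    refine ⟨fun e => w e / M, fun W => ?_, fun B hB => ⟨fun hσ => ?_, fun hσ => ?_⟩⟩
    · rw [hdiv, abs_div, abs_of_pos hM0, div_lt_one hM0]
      have : |∑ e, w e * cob s t (indic W) e| ≤ ∑ e, |w e| := by
        refine (abs_sum_le_sum_abs _ _).trans (sum_le_sum fun e _ => ?_)
        rw [abs_mul]
        refine mul_le_of_le_one_right (abs_nonneg _) ?_
        simp only [cob, indic]
        split_ifs <;> simp
      linarith
    · rw [hdiv]
      have := hw B hB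
      simp only [cocycVec_eq, hσ, if_true, one_mul] at this
      positivity
    · rw [hdiv]
      have := hw B hB
      simp only [cocycVec_eq, hσ, Bool.false_eq_true, if_false, neg_one_mul, mul_neg,
        sum_neg_distrib] at this
      exact div_neg_of_neg_of_pos (by linarith) hM0
  let S : Set (Finset V → ℝ) :=
    stdSimplex ℝ (Finset V) ∩ ⋂ W ∈ {W | ¬ Biconn s t W}, {a | a W = 0}
  let L : (Finset V → ℝ) →ₗ[ℝ] (E → ℝ) := Fintype.linearCombination ℝ (cocycVec s t σ)
  have hL : ∀ a, L a = ∑ W, a W • cocycVec s t σ W := fun a => rfl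
  have hScompact : IsCompact S := (isCompact_stdSimplex ℝ _).inter_right
    (isClosed_biInter fun W _ => isClosed_eq (continuous_apply W) continuous_const)
  have hSconvex : Convex ℝ S := by
    refine (convex_stdSimplex ℝ _).inter (convex_iInter₂ fun W _ => ?_)
    intro a ha b hb x y _ _ _
    simp only [Set.mem_ofPred_eq] at ha hb ⊢
    simp [ha, hb]
  have h0 : (0 : E → ℝ) ∉ L '' S := by
    rintro ⟨a, ⟨⟨ha0, ha1⟩, haB⟩, hLa⟩
    simp only [Set.mem_iInter, Set.mem_ofPred_eq] at haB
    have := hacy a ha0 haB (by rw [← hL, hLa])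
    simp [this] at ha1
  obtain ⟨φ, u, hu0, hu⟩ := geometric_hahn_banach_point_closed (hSconvex.linear_image L)
    (hScompact.image L.continuous_of_finiteDimensional).isClosed h0
  refine ⟨fun e => φ (Pi.single e 1), fun B hB => ?_⟩
  have h1 : Pi.single B 1 ∈ S := by
    refine ⟨single_mem_stdSimplex ℝ B, ?_⟩
    simp only [Set.mem_iInter, Set.mem_ofPred_eq]
    intro W hW
    exact Pi.single_eq_of_ne (by rintro rfl; exact hW hB) _
  have h2 := hu _ ⟨_, h1, rfl⟩
  have h3 : L (Pi.single B 1) = cocycVec s t σ B := by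
    simp [L, Fintype.linearCombination_apply_single]
  rw [map_zero] at hu0
  rw [h3, pi_eq_sum_univ' (cocycVec s t σ B), map_sum] at h2
  simp only [map_smul, smul_eq_mul] at h2
  simp only [mul_comm (φ _)]
  linarith

/-- The cut condition on indicator functions implies the corresponding inequality for all
functions. -/
theorem sum_mul_cob_le_of_cut {p : E → ℝ}
    (hp : ∀ W : Finset V, ∑ e, p e * cob s t (indic W) e ≤ ∑ e, max (cob s t (indic W) e) 0)
    (y : V → ℝ) : ∑ e, p e * cob s t y e ≤ ∑ e, max (cob s t y e) 0 := by
  suffices h : ∀ n : ℕ, ∀ y : V → ℝ, (∀ v, 0 ≤ y v) → (univ.filter fun v => 0 < y v).card = n →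
      ∑ e, p e * cob s t y e ≤ ∑ e, max (cob s t y e) 0 by
    have h1 : ∀ v, 0 ≤ y v + ∑ v, |y v| := fun v => by
      have := single_le_sum (fun v _ => abs_nonneg (y v)) (mem_univ v)
      have := neg_abs_le (y v)
      linarith
    have h2 := h _ (fun v => y v + ∑ v, |y v|) h1 rfl
    have h3 : cob s t (fun v => y v + ∑ v, |y v|) = cob s t y := by
      ext e
      simp [cob]
    rwa [h3] at h2
  intro n
  induction n using Nat.strong_induction_on with
  | _ n ih =>
  intro y hy hn
  set W := univ.filter fun v => 0 < y v with hW
  have hmem : ∀ v, v ∈ W ↔ 0 < y v := fun v => by simp [hW]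
  obtain hempty | hne := W.eq_empty_or_nonempty
  · have hy0 : ∀ v, y v = 0 := fun v => by
      refine le_antisymm (not_lt.1 fun h => ?_) (hy v)
      have := (hmem v).2 h
      simp [hempty] at this
    simp [cob, hy0]
  · obtain ⟨a, haW, ha⟩ := W.exists_min_image y hne
    have ha0 := (hmem a).1 haW
    have hy' : ∀ v, 0 ≤ y v - y a * indic W v := by
      intro v
      by_cases hv : v ∈ W
      · simpa [indic, hv] using ha v hv
      · simpa [indic, hv] using hy v
    have hcard : (univ.filter fun v => 0 < y v - y a * indic W v).card < n := by
      rw [← hn]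
      refine card_lt_card ((ssubset_iff_of_subset ?_).2 ⟨a, haW, by simp [indic, haW]⟩)
      intro v hv
      by_contra hvW
      have h0 : ¬ 0 < y v := fun h => hvW ((hmem v).2 h)
      simp [indic, hvW] at hv
      exact h0 hv
    have h1 := ih _ hcard _ hy' rfl
    have h2 := mul_le_mul_of_nonneg_left (hp W) ha0.le
    have h3 : ∀ e, p e * cob s t y e = p e * cob s t (fun v => y v - y a * indic W v) e +
        y a * (p e * cob s t (indic W) e) := fun e => by simp only [cob]; ring
    have h4 : ∀ e, max (cob s t y e) 0 = max (cob s t (fun v => y v - y a * indic W v) e) 0 +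
        y a * max (cob s t (indic W) e) 0 := by
      intro e
      by_cases hs : s e ∈ W <;> by_cases ht : t e ∈ W
      · simp [cob, indic, hs, ht]
      · have h5 := hy (t e)
        have h6 : ¬ 0 < y (t e) := fun h => ht ((hmem _).2 h)
        have h7 := ha _ hs
        simp only [cob, indic, hs, ht, if_true, if_false]
        rw [max_eq_right, max_eq_right, max_eq_right] <;> linarith
      · have h5 := hy (s e)
        have h6 : ¬ 0 < y (s e) := fun h => hs ((hmem _).2 h)
        have h7 := ha _ ht
        simp only [cob, indic, hs, ht, if_true, if_false]
        rw [max_eq_left, max_eq_left, max_eq_left] <;> linarith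
      · simp [cob, indic, hs, ht]
    simp only [h3, h4, sum_add_distrib, ← mul_sum]
    linarith

/-- A real form of Hakimi's theorem: under the cut condition, a chain is homologous to one with
coefficients in the unit interval. -/
theorem exists_bdry_eq_of_cut {p : E → ℝ}
    (hp : ∀ W : Finset V, ∑ e, p e * cob s t (indic W) e ≤ ∑ e, max (cob s t (indic W) e) 0) :
    ∃ x ∈ Set.Icc (0 : E → ℝ) 1, bdry s t x = bdry s t p := by
  let L : (E → ℝ) →ₗ[ℝ] (V → ℝ) :=
    { toFun := bdry s t
      map_add' := fun x y => funext fun v => bdry_add x y v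
      map_smul' := fun c x => funext fun v => bdry_smul c x v }
  by_contra hno
  have hmem : bdry s t p ∉ L '' Set.Icc (0 : E → ℝ) 1 := fun ⟨x, hx, h⟩ => hno ⟨x, hx, h⟩
  obtain ⟨φ, u, hu, hup⟩ := geometric_hahn_banach_closed_point
    ((convex_Icc (0 : E → ℝ) 1).linear_image L)
    (isCompact_Icc.image L.continuous_of_finiteDimensional).isClosed hmem
  set y : V → ℝ := fun v => φ (Pi.single v 1) with hy
  have hφ : ∀ z : E → ℝ, φ (bdry s t z) = ∑ e, z e * cob s t y e := by
    intro z
    rw [← sum_mul_bdry]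
    conv_lhs => rw [pi_eq_sum_univ' (bdry s t z), map_sum]
    refine sum_congr rfl fun v _ => ?_
    rw [map_smul, smul_eq_mul, mul_comm]
  have h1 := hu _ ⟨fun e => if 0 ≤ cob s t y e then 1 else 0, ⟨fun e => ?_, fun e => ?_⟩, rfl⟩
  · have h2 : φ (L fun e => if 0 ≤ cob s t y e then 1 else 0) = ∑ e, max (cob s t y e) 0 := by
      refine (hφ _).trans (sum_congr rfl fun e _ => ?_)
      split_ifs with h
      · rw [max_eq_left h, one_mul]
      · rw [max_eq_right (not_le.1 h).le, zero_mul]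
    rw [h2] at h1
    rw [hφ] at hup
    have := sum_mul_cob_le_of_cut hp y
    linarith
  · dsimp only [Pi.zero_apply]
    split_ifs <;> norm_num
  · dsimp only [Pi.one_apply]
    split_ifs <;> norm_num

omit [Fintype V] in
/-- Subtracting a suitable integral coboundary from a chain enforces the cut condition. -/
theorem exists_cut_condition (z : E → ℝ) : ∃ f : V → ℤ, ∀ W : Finset V,
    ∑ e, (z e - cob s t (fun v => (f v : ℝ)) e) * cob s t (indic W) e ≤
      ∑ e, max (cob s t (indic W) e) 0 := by
  let Q : (E → ℤ) → ℝ := fun n => ∑ e, (z e - 1 / 2 - n e) ^ 2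
  let d : (V → ℤ) → E → ℤ := fun f e => f (t e) - f (s e)
  have hfin : {n | n ∈ Set.range d ∧ Q n ≤ Q 0}.Finite := by
    let M : ℤ := ⌈Q 0⌉
    have hM : Q 0 ≤ M := Int.le_ceil _
    refine (Set.finite_Icc (fun e => ⌊z e - 1 / 2⌋ - M - 1) fun e => ⌈z e - 1 / 2⌉ + M + 1).subset ?_
    rintro n ⟨-, hn⟩
    have hsq : ∀ e, (z e - 1 / 2 - n e) ^ 2 ≤ M := fun e =>
      (single_le_sum (f := fun e => (z e - 1 / 2 - n e) ^ 2) (fun e _ => sq_nonneg _)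
        (mem_univ e)).trans (hn.trans hM)
    refine ⟨fun e => ?_, fun e => ?_⟩
    · have h1 := hsq e
      have h2 := Int.floor_le (z e - 1 / 2)
      have : ((⌊z e - 1 / 2⌋ - M - 1 : ℤ) : ℝ) ≤ n e := by
        push_cast
        nlinarith [sq_nonneg (z e - 1 / 2 - n e + 1)]
      exact_mod_cast this
    · have h1 := hsq e
      have h2 := Int.le_ceil (z e - 1 / 2)
      have : (n e : ℝ) ≤ ((⌈z e - 1 / 2⌉ + M + 1 : ℤ) : ℝ) := by
        push_cast
        nlinarith [sq_nonneg (z e - 1 / 2 - n e - 1)]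
      exact_mod_cast this
  obtain ⟨n, ⟨⟨f, rfl⟩, hn0⟩, hmin⟩ := Set.exists_min_image _ Q hfin
    ⟨0, ⟨0, by ext; simp [d]⟩, le_rfl⟩
  have hmin' : ∀ f', Q (d f) ≤ Q (d f') := fun f' => by
    by_cases h : Q (d f') ≤ Q 0
    · exact hmin _ ⟨⟨f', rfl⟩, h⟩
    · exact hn0.trans (not_le.1 h).le
  refine ⟨f, fun W => ?_⟩
  have h1 := hmin' fun v => f v + if v ∈ W then 1 else 0
  have h2 : Q (d fun v => f v + if v ∈ W then 1 else 0) = Q (d f) +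
      2 * (∑ e, max (cob s t (indic W) e) 0 -
        ∑ e, (z e - cob s t (fun v => (f v : ℝ)) e) * cob s t (indic W) e) := by
    simp only [Q]
    rw [← sum_sub_distrib, mul_sum, ← sum_add_distrib]
    refine sum_congr rfl fun e _ => ?_
    simp only [d, cob, indic]
    push_cast
    split_ifs <;> norm_num <;> ring
  linarith

/-- The fractional part of an extreme point of a transportation polytope contains no cycle. -/
theorem exists_isSpanningTree_of_mem_extremePoints [DecidableEq E] {b : V → ℝ} {x : E → ℝ}
    (hx : x ∈ Set.extremePoints ℝ {x | x ∈ Set.Icc (0 : E → ℝ) 1 ∧ bdry s t x = b})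
    (hF : ConnOn s t (univ.filter fun e => 0 < x e ∧ x e < 1) univ) :
    IsSpanningTree s t (univ.filter fun e => 0 < x e ∧ x e < 1) := by
  set F := univ.filter fun e => 0 < x e ∧ x e < 1 with hFdef
  have hmem : ∀ e, e ∈ F ↔ 0 < x e ∧ x e < 1 := fun e => by simp [hFdef]
  obtain ⟨T, hTF, hT⟩ := hF.exists_isSpanningTree
  suffices h : F ⊆ T from (Subset.antisymm hTF h) ▸ hT
  intro e₀ he₀
  by_contra heT
  obtain ⟨⟨hxI, hxb⟩, hext⟩ := mem_extremePoints.1 hx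
  obtain ⟨z', hz'T, hz'⟩ := exists_bdry_of_reach (hT.1.2 (t e₀) (mem_univ _) (s e₀) (mem_univ _))
  set z := z' + Pi.single e₀ 1 with hz
  have hzb : bdry s t z = 0 := by
    ext v
    rw [bdry_add, hz', bdry_single]
    simp
  have hzF : ∀ e ∉ F, z e = 0 := fun e he => by
    have h1 : e ∉ T := fun h => he (hTF h)
    have h2 : e ≠ e₀ := fun h => he (by rwa [h])
    simp [hz, hz'T e h1, h2]
  have hz1 : z e₀ = 1 := by simp [hz, hz'T e₀ heT]
  have hsmall : ∀ᶠ c : ℝ in nhds 0, ∀ e, 0 ≤ x e + c * z e ∧ x e + c * z e ≤ 1 := by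
    refine Filter.eventually_all.2 fun e => ?_
    have hcont : Filter.Tendsto (fun c : ℝ => x e + c * z e) (nhds 0) (nhds (x e)) := by
      have : Continuous fun c : ℝ => x e + c * z e := by fun_prop
      simpa using this.tendsto 0
    by_cases he : e ∈ F
    · filter_upwards [hcont.eventually (lt_mem_nhds ((hmem e).1 he).1),
        hcont.eventually (gt_mem_nhds ((hmem e).1 he).2)] with c h1 h2 using ⟨h1.le, h2.le⟩
    · exact Filter.Eventually.of_forall fun c => by
        simpa [hzF e he] using ⟨hxI.1 e, hxI.2 e⟩
  have hneg : ∀ᶠ c : ℝ in nhds 0, ∀ e, 0 ≤ x e + -c * z e ∧ x e + -c * z e ≤ 1 := by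
    have : Filter.Tendsto (fun c : ℝ => -c) (nhds 0) (nhds 0) := by
      simpa using (continuous_neg (G := ℝ)).tendsto 0
    exact this.eventually hsmall
  obtain ⟨c, ⟨hc1, hc2⟩, hc⟩ := (((hsmall.and hneg).filter_mono nhdsWithin_le_nhds).and
    (self_mem_nhdsWithin (s := Set.Ioi (0 : ℝ)))).exists
  have hmemP : ∀ c : ℝ, (∀ e, 0 ≤ x e + c * z e ∧ x e + c * z e ≤ 1) →
      x + c • z ∈ {x | x ∈ Set.Icc (0 : E → ℝ) 1 ∧ bdry s t x = b} := by
    refine fun c hc => ⟨⟨fun e => (hc e).1, fun e => (hc e).2⟩, ?_⟩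
    ext v
    rw [bdry_add, bdry_smul, hzb, hxb]
    simp
  have hseg : x ∈ openSegment ℝ (x + c • z) (x + -c • z) := by
    refine ⟨1 / 2, 1 / 2, by norm_num, by norm_num, by norm_num, ?_⟩
    ext e
    simp only [Pi.add_apply, Pi.smul_apply, smul_eq_mul]
    ring
  have h := congrFun (hext _ (hmemP c hc1) _ (hmemP (-c) hc2) hseg).1 e₀
  simp only [Pi.add_apply, Pi.smul_apply, smul_eq_mul, hz1, mul_one, add_eq_left] at h
  exact (ne_of_gt hc) h

end Convexity

section BreakDivisors

variable {s t : E → V} [Fintype V] [Fintype E] [DecidableEq V] [DecidableEq E]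

/-- Generalized break divisors are the indegree divisors, shifted by `q - 1`, of the orientations
that agree with the signature on the edges of some spanning tree. -/
theorem mem_BDset_iff {σ : Finset V → Bool} {q : V} {D : V → ℤ} :
    D ∈ BDset s t σ q ↔ ∃ T o, IsSpanningTree s t T ∧
      (∀ e ∈ T, o e = sigmaOrient s t σ T e) ∧
      ∀ v, (D v : ℝ) = tailCount s v + bdry s t (bval o) v - 1 + (if v = q then 1 else 0) := by
  have key : ∀ (T : Finset E) (o o' : E → Bool), (∀ e ∈ T, o' e = sigmaOrient s t σ T e) →
      (∀ e ∉ T, o' e = o e) → ∀ v, ((breakDiv s t T o v + IG s t σ q T v : ℤ) : ℝ) =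
        tailCount s v + bdry s t (bval o') v - 1 + (if v = q then 1 else 0) := by
    intro T o o' hT hT' v
    have h1 : (univ.filter fun e => ohead s t o' e = v).card =
        (univ.filter fun e => e ∉ T ∧ ohead s t o e = v).card +
        (T.filter fun e => ohead s t (sigmaOrient s t σ T) e = v).card := by
      rw [← card_union_of_disjoint]
      · congr 1
        ext e
        simp only [mem_filter, mem_union, mem_univ, true_and]
        by_cases he : e ∈ T <;> simp [he, ohead, hT, hT']
      · rw [Finset.disjoint_left]
        simp +contextual
    have h2 : ((univ.filter fun e => ohead s t o' e = v).card : ℝ) =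
        tailCount s v + bdry s t (bval o') v := by
      rw [card_filter]
      simp only [tailCount, bdry]
      push_cast
      rw [← sum_add_distrib]
      refine sum_congr rfl fun e _ => ?_
      cases h : o' e <;> simp [ohead, bval, h]
    rw [← h2, h1]
    simp only [breakDiv, IG]
    push_cast
    ring
  constructor
  · rintro ⟨T, o, hT, rfl⟩
    exact ⟨T, fun e => if e ∈ T then sigmaOrient s t σ T e else o e, hT,
      fun e he => by simp [he], key T o _ (fun e he => by simp [he]) fun e he => by simp [he]⟩
  · rintro ⟨T, o, hT, ho, hD⟩
    refine ⟨T, o, hT, funext fun v => ?_⟩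
    have := (hD v).trans (key T o o ho (fun _ _ => rfl) v).symm
    exact_mod_cast this

omit [DecidableEq E] in
theorem sum_tailCount (s : E → V) : ∑ v, tailCount s v = Fintype.card E := by
  simp only [tailCount]
  rw [sum_comm]
  simp

omit [DecidableEq E] in
theorem sum_bdry (z : E → ℝ) : ∑ v, bdry s t z v = 0 := by
  have := sum_mul_bdry (s := s) (t := t) (fun _ => 1) z
  simpa [cob] using this

/-- The real chain `w` induces the signature `σ`. -/
def Induces (s t : E → V) (w : E → ℝ) (σ : Finset V → Bool) : Prop :=
  ∀ B, Biconn s t B → (σ B = true → 0 < ∑ e, w e * cob s t (indic B) e) ∧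
    (σ B = false → ∑ e, w e * cob s t (indic B) e < 0)

/-- A cut directed inwards on the tree edges, which are oriented by `σ`, pairs nonnegatively with
the chain inducing `σ`. -/
theorem Induces.nonneg_of_directed {σ : Finset V → Bool} {w : E → ℝ} (hw : Induces s t w σ)
    {T : Finset E} (hT : IsSpanningTree s t T) {W : Finset V}
    (h : ∀ e ∈ T, e ∈ cutEdges s t W → (sigmaOrient s t σ T e = true ↔ t e ∈ W)) :
    0 ≤ ∑ e, w e * cob s t (indic W) e := by
  rw [sum_mul_cob_eq_sum_treeSide hT]
  refine sum_nonneg fun e he => ?_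
  have hB := hw _ (biconn_treeSide hT he)
  by_cases hcut : e ∈ cutEdges s t W
  · have h1 := h e he hcut
    rw [mem_cutEdges] at hcut
    simp only [sigmaOrient] at h1
    by_cases ht : t e ∈ W
    · have h2 : s e ∉ W := by tauto
      have h3 := hB.2 (by simpa [ht] using h1)
      rw [cob_indic_of_target_mem h2 ht]
      linarith
    · have h2 : s e ∈ W := by tauto
      have h3 := hB.1 (by simpa [ht] using h1)
      rw [cob_indic_of_source_mem h2 ht]
      linarith
  · rw [mem_cutEdges, not_not] at hcut
    rw [cob_indic_eq_zero hcut]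
    simp

omit [DecidableEq E] in
theorem Induces.ne_zero {σ : Finset V → Bool} {w : E → ℝ} (hw : Induces s t w σ) {B : Finset V}
    (hB : Biconn s t B) : ∑ e, w e * cob s t (indic B) e ≠ 0 := by
  cases h : σ B
  · exact ((hw B hB).2 h).ne
  · exact ((hw B hB).1 h).ne'

/-- Linearly equivalent generalized break divisors are equal. -/
theorem Induces.eq_of_linEquiv {σ : Finset V → Bool} {w : E → ℝ} (hw : Induces s t w σ)
    (hconn : ConnOn s t univ univ) {q : V} {D₁ D₂ : V → ℤ} (h₁ : D₁ ∈ BDset s t σ q)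
    (h₂ : D₂ ∈ BDset s t σ q) {f : V → ℤ} (hf : ∀ v, D₁ v - D₂ v = lap s t f v) : D₁ = D₂ := by
  obtain ⟨T₁, o₁, hT₁, ho₁, hD₁⟩ := mem_BDset_iff.1 h₁
  obtain ⟨T₂, o₂, hT₂, ho₂, hD₂⟩ := mem_BDset_iff.1 h₂
  obtain ⟨a, -, ha⟩ := exists_max_image univ f hconn.1
  set W := univ.filter fun v => f v = f a with hW
  have hmem : ∀ v, v ∈ W ↔ f v = f a := fun v => by simp [hW]
  obtain hempty | hne := Wᶜ.eq_empty_or_nonempty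
  · have hconst : ∀ v, f v = f a := fun v => by
      rw [compl_eq_empty_iff] at hempty
      exact (hmem v).1 (hempty ▸ mem_univ v)
    ext v
    have h := hf v
    simp only [lap, hconst, sub_self, mul_zero, sum_const_zero] at h
    omega
  exfalso
  have hbd : ∀ v, bdry s t (bval o₁ - bval o₂ - cob s t fun v => (f v : ℝ)) v = 0 := by
    intro v
    have h := hf v
    rw [bdry_sub, bdry_sub, ← lap_eq_bdry, ← h]
    push_cast
    rw [hD₁, hD₂]
    ring
  have hsum := sum_mul_bdry (s := s) (t := t) (indic W)
    (bval o₁ - bval o₂ - cob s t fun v => (f v : ℝ))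
  simp only [hbd, mul_zero, sum_const_zero] at hsum
  have hle : ∀ v ∉ W, (f v : ℝ) + 1 ≤ f a := by
    intro v hv
    have h1 := ha v (mem_univ v)
    have h2 : f v ≠ f a := fun h => hv ((hmem v).2 h)
    have : f v + 1 ≤ f a := by omega
    exact_mod_cast this
  have hterm : ∀ e, (bval o₁ - bval o₂ - cob s t fun v => (f v : ℝ)) e * cob s t (indic W) e ≤ 0 ∧
      (e ∈ cutEdges s t W →
        (bval o₁ - bval o₂ - cob s t fun v => (f v : ℝ)) e * cob s t (indic W) e = 0 →
        (o₁ e = true ↔ t e ∈ W) ∧ (o₂ e = true ↔ t e ∉ W)) := by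
    intro e
    rw [mem_cutEdges]
    by_cases hs : s e ∈ W <;> by_cases ht : t e ∈ W
    · simp [cob_indic_eq_zero, hs, ht]
    · rw [cob_indic_of_source_mem hs ht]
      have h1 := hle _ ht
      have h2 := (hmem _).1 hs
      have h3 := ha (t e) (mem_univ _)
      simp only [Pi.sub_apply, cob, bval, h2, hs, ht]
      cases o₁ e <;> cases o₂ e <;> simp <;> try constructor
      all_goals linarith
    · rw [cob_indic_of_target_mem hs ht]
      have h1 := hle _ hs
      have h2 := (hmem _).1 ht
      have h3 := ha (s e) (mem_univ _)
      simp only [Pi.sub_apply, cob, bval, h2, hs, ht]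
      cases o₁ e <;> cases o₂ e <;> simp <;> try constructor
      all_goals linarith
    · simp [cob_indic_eq_zero, hs, ht]
  have hzero := (sum_eq_zero_iff_of_nonpos fun e _ => (hterm e).1).1 hsum.symm
  obtain ⟨B, hB, hBW⟩ := exists_biconn hconn ⟨a, (hmem a).2 rfl⟩ hne
  have hdir : ∀ e ∈ cutEdges s t B,
      (o₁ e = true ↔ t e ∈ B) ∧ (o₂ e = true ↔ t e ∈ Bᶜ) := by
    intro e he
    obtain ⟨h1, h2⟩ := hBW e he
    have h3 := (hterm e).2 h1 (hzero e (mem_univ e))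
    rw [mem_cutEdges] at he h1
    rw [mem_compl]
    tauto
  have hpos := hw.nonneg_of_directed hT₁ (W := B) fun e he hcut => by
    rw [← ho₁ e he]
    exact (hdir e hcut).1
  have hneg := hw.nonneg_of_directed hT₂ (W := Bᶜ) fun e he hcut => by
    rw [← ho₂ e he]
    refine (hdir e ?_).2
    rw [mem_cutEdges] at hcut ⊢
    simp only [mem_compl] at hcut
    tauto
  simp only [cob_indic_compl, mul_neg, sum_neg_distrib] at hneg
  exact hw.ne_zero hB (by linarith)

/-- Every divisor of degree `g` is linearly equivalent to a generalized break divisor. -/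
theorem Induces.exists_mem_BDset {σ : Finset V → Bool} {w : E → ℝ} (hw : Induces s t w σ)
    (hw1 : ∀ W : Finset V, |∑ e, w e * cob s t (indic W) e| < 1)
    (hconn : ConnOn s t univ univ) (q : V) {D : V → ℤ} (hD : ∑ v, D v = genus s t) :
    ∃ D' ∈ BDset s t σ q, LinEquiv s t D D' := by
  let N : V → ℤ := fun v => D v - (if v = q then 1 else 0) + 1 - tailCount s v
  have hN : ∑ v, N v = 0 := by
    simp only [N, sum_sub_distrib, sum_add_distrib, sum_tailCount, hD, genus]
    simp
  have hN' : ∑ v, ((N v : ℝ) - bdry s t w v) = 0 := by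
    rw [sum_sub_distrib, sum_bdry, sub_zero]
    exact_mod_cast hN
  obtain ⟨z, hz⟩ := exists_bdry_eq hconn hN'
  obtain ⟨f, hf⟩ := exists_cut_condition (s := s) (t := t) z
  obtain ⟨x₀, hx₀, hx₀b⟩ := exists_bdry_eq_of_cut hf
  set b := bdry s t fun e => z e - cob s t (fun v => (f v : ℝ)) e with hb
  let M : V → ℤ := fun v => N v - lap s t f v
  have hbM : ∀ v, b v = M v - bdry s t w v := by
    intro v
    have h1 : b v = bdry s t z v - bdry s t (cob s t fun v => (f v : ℝ)) v := bdry_sub _ _ v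
    rw [h1, hz, ← lap_eq_bdry]
    simp only [M]
    push_cast
    ring
  have hcompact : IsCompact {x | x ∈ Set.Icc (0 : E → ℝ) 1 ∧ bdry s t x = b} := by
    refine isCompact_Icc.inter_right (isClosed_eq (continuous_pi fun v => ?_) continuous_const)
    unfold bdry
    fun_prop
  obtain ⟨x, hx⟩ := hcompact.extremePoints_nonempty ⟨x₀, hx₀, hx₀b⟩
  have hxI : x ∈ Set.Icc (0 : E → ℝ) 1 := hx.1.1
  have hxb : bdry s t x = b := hx.1.2
  set T := univ.filter fun e => 0 < x e ∧ x e < 1 with hTdef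
  have hmem : ∀ e, e ∈ T ↔ 0 < x e ∧ x e < 1 := fun e => by simp [hTdef]
  let o : E → Bool := fun e => if e ∈ T then sigmaOrient s t σ T e else decide (x e = 1)
  have hoT : ∀ e ∉ T, bval o e = x e := by
    intro e he
    have h0 : 0 ≤ x e := hxI.1 e
    have h1 : x e ≤ 1 := hxI.2 e
    rw [hmem, not_and] at he
    by_cases hx1 : x e = 1
    · simp [bval, o, hmem, hx1]
    · have hx0 : x e = 0 := le_antisymm (not_lt.1 fun h => hx1 (le_antisymm h1 (not_lt.1 (he h)))) h0
      simp [bval, o, hmem, hx0]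
  have hint : ∀ W : Finset V, ∃ m : ℤ, ∑ e, (bval o - x - w) e * cob s t (indic W) e = m := by
    intro W
    refine ⟨∑ e, (if o e then 1 else 0) * ((if t e ∈ W then 1 else 0) - if s e ∈ W then 1 else 0) -
      ∑ v, (if v ∈ W then 1 else 0) * M v, ?_⟩
    have h1 := sum_mul_bdry (s := s) (t := t) (indic W) (x + w)
    have h2 : ∀ v, bdry s t (x + w) v = M v := fun v => by
      rw [bdry_add, hxb, hbM]
      ring
    simp only [h2, indic, Pi.add_apply] at h1
    push_cast
    rw [h1, ← sum_sub_distrib]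
    refine sum_congr rfl fun e _ => ?_
    simp only [Pi.sub_apply, bval, cob]
    unfold indic
    ring
  have hconnT : ConnOn s t T univ := by
    by_contra hnot
    obtain ⟨A, -, hA, hA', hsplit⟩ := exists_split_of_not_connOn hconn.1 hnot
    simp only [mem_univ, true_imp_iff] at hsplit
    obtain ⟨B, hB, hBA⟩ := exists_biconn hconn hA (by simpa [compl_eq_univ_sdiff] using hA')
    obtain ⟨m, hm⟩ := hint B
    have h1 : ∑ e, (bval o - x - w) e * cob s t (indic B) e =
        -∑ e, w e * cob s t (indic B) e := by
      rw [← sum_neg_distrib]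
      refine sum_congr rfl fun e _ => ?_
      by_cases he : e ∈ cutEdges s t B
      · have h2 : e ∉ T := fun h => mem_cutEdges.1 (hBA e he).1 (hsplit e h)
        simp [hoT e h2]
      · rw [mem_cutEdges, not_not] at he
        simp [cob_indic_eq_zero he]
    have h2 := hw1 B
    rw [← abs_neg, ← h1, hm] at h2
    have h3 : m = 0 := Int.abs_lt_one_iff.1 (by exact_mod_cast h2)
    refine hw.ne_zero hB ?_
    rw [← neg_eq_zero, ← h1, hm, h3, Int.cast_zero]
  have hT : IsSpanningTree s t T := exists_isSpanningTree_of_mem_extremePoints hx hconnT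
  have hcut : ∀ e ∈ T, ∑ e', (bval o - x - w) e' * cob s t (indic (treeSide s t T e)) e' = 0 := by
    intro e he
    obtain ⟨m, hm⟩ := hint (treeSide s t T e)
    have h1 : ∑ e', (bval o - x) e' * cob s t (indic (treeSide s t T e)) e' = x e - bval o e := by
      rw [sum_eq_single_of_mem e (mem_univ e), cob_indic_of_source_mem (source_mem_treeSide T e)
        (target_notMem_treeSide hT he), Pi.sub_apply]
      · ring
      · intro e' _ hne
        by_cases he' : e' ∈ T
        · rw [cob_indic_eq_zero (mem_treeSide_iff_of_ne he' hne), mul_zero]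
        · simp [hoT e' he']
    have h2 : ∑ e', (bval o - x - w) e' * cob s t (indic (treeSide s t T e)) e' =
        x e - bval o e - ∑ e', w e' * cob s t (indic (treeSide s t T e)) e' := by
      rw [← h1, ← sum_sub_distrib]
      exact sum_congr rfl fun e' _ => by rw [Pi.sub_apply _ w, sub_mul]
    have h3 := abs_lt.1 (hw1 (treeSide s t T e))
    have h4 := hw _ (biconn_treeSide hT he)
    have h5 := (hmem e).1 he
    have h6 : |(m : ℝ)| < 1 := by
      rw [← hm, h2, abs_lt]
      cases hσ : σ (treeSide s t T e)
      · have h7 := h4.2 hσ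
        have h8 : bval o e = 1 := by simp [bval, o, he, sigmaOrient, hσ]
        constructor <;> linarith
      · have h7 := h4.1 hσ
        have h8 : bval o e = 0 := by simp [bval, o, he, sigmaOrient, hσ]
        constructor <;> linarith
    have h7 : m = 0 := Int.abs_lt_one_iff.1 (by exact_mod_cast h6)
    rw [hm, h7, Int.cast_zero]
  have hbd : ∀ v, bdry s t (bval o) v = M v := by
    intro v
    have h1 := sum_mul_bdry (s := s) (t := t) (Pi.single v 1) (bval o - x - w)
    rw [sum_mul_cob_eq_sum_treeSide hT, sum_eq_zero (s := T) fun e he => by rw [hcut e he, mul_zero]]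
      at h1
    simp only [Pi.single_apply, ite_mul, one_mul, zero_mul, sum_ite_eq', mem_univ, if_true,
      bdry_sub, hxb, hbM] at h1
    linarith
  refine ⟨fun v => D v - lap s t f v, mem_BDset_iff.2 ⟨T, o, hT, fun e he => by simp [o, he],
    fun v => ?_⟩, f, fun v => by ring⟩
  rw [hbd]
  simp only [M, N]
  push_cast
  ring

end BreakDivisors

end ChipFiring

section Statements

variable {V E : Type*} [Fintype V] [Fintype E] [DecidableEq V] [DecidableEq E]

/-- For an acyclic cocycle signature `σ*` and `q ∈ V(G)`, every divisor of
degree `g` is linearly equivalent to exactly one element of `BD_{I_G^{σ*}}(G)`. -/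
theorem stmt_9 (s t : E → V) (hloop : ∀ e, s e ≠ t e)
    (hconn : ConnOn s t Finset.univ Finset.univ)
    (q : V) (σ : Finset V → Bool) (hsig : IsSignature s t σ) (hacy : AcyclicSig s t σ) :
    ∀ D : V → ℤ, (∑ v : V, D v) = genus s t →
      ∃! D' : V → ℤ, D' ∈ BDset s t σ q ∧ LinEquiv s t D D' := by
  intro D hD
  obtain ⟨w, hw1, hw⟩ := hacy.exists_chain
  replace hw : Induces s t w σ := hw
  obtain ⟨D', hD', hDD'⟩ := hw.exists_mem_BDset hw1 hconn q hD
  refine ⟨D', ⟨hD', hDD'⟩, fun D'' ⟨hD'', hDD''⟩ => ?_⟩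
  obtain ⟨f', hf'⟩ := hDD'
  obtain ⟨f'', hf''⟩ := hDD''
  refine hw.eq_of_linEquiv hconn hD'' hD' (f := f' - f'') fun v => ?_
  have : lap s t (f' - f'') v = lap s t f' v - lap s t f'' v := by
    simp only [lap, ← sum_sub_distrib, Pi.sub_apply]
    exact sum_congr rfl fun e _ => by ring
  rw [this, ← hf', ← hf'']
  ring

end Statements
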